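/- Let V be a weak lower perfect space with lower perfect basis B. For any b ∈ B, any n ∈ ℤ_{≥0} and any (i,l) ∈ I^∞, there exists c ∈ k^× such that 𝚏_{il}^n(b) − c·𝐟_{il}^n(b) ∈ 𝚏_{il}^{d_{il}(b)+n+1} V, where 𝐟_{il}^n(b) denotes the n-fold application of 𝐟_{il} to b (with value 0 if it vanishes at some stage, the term c·𝐟_{il}^n(b) then being 0). -/

import Mathlib

noncomputable section

open Function Set

/-- An even symmetrizable Borcherds–Cartan datum: a countable index set `I`, an
even symmetrizable Borcherds–Cartan matrix `a`, a symmetrizing diagonal `s`,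
a free abelian weight lattice `P` and linearly independent simple roots `α`. -/
structure BCDatum (I : Type*) (P : Type*) [AddCommGroup P] where
  a : I → I → ℤ
  s : I → ℤ
  α : I → P
  countable_index : Countable I
  even_diag : ∀ i, Even (a i i)
  diag_le_two : ∀ i, a i i ≤ 2
  offdiag_nonpos : ∀ i j, i ≠ j → a i j ≤ 0
  s_pos : ∀ i, 0 < s i
  symmetrizable : ∀ i j, s i * a i j = s j * a j i
  free_weight : Module.Free ℤ P
  roots_indep : LinearIndependent ℤ α

namespace BCDatum

variable {I P : Type*} [AddCommGroup P] (D : BCDatum I P)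

/-- `I^∞ = I^re ⊔ (I^im × ℤ_{>0})`. -/
abbrev Iinf : Type _ := {i : I // D.a i i = 2} ⊕ ({i : I // D.a i i ≤ 0} × ℕ+)

/-- The weight `l·α_i` attached to an element of `I^∞` (with `l = 1` in the real case). -/
def wtOf (x : D.Iinf) : P :=
  Sum.elim (fun i => D.α i.1) (fun p => (p.2 : ℕ) • D.α p.1.1) x

/-- `R_+ = Σ_i ℤ_{≥0} α_i`. -/
def Rplus : Set P := {μ | ∃ c : I →₀ ℕ, μ = c.sum fun i n => n • D.α i}

end BCDatum

/-- A good sequence of indices: every element of `I^∞` appears infinitely often. -/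
def GoodIdxSeq {I P : Type*} [AddCommGroup P] {D : BCDatum I P} (gi : ℕ → D.Iinf) : Prop :=
  ∀ x : D.Iinf, ∀ N : ℕ, ∃ n, N ≤ n ∧ gi n = x

/-- Lexicographic strict order on integer sequences: `SeqLt a b` means `a < b`. -/
def SeqLt (a b : ℕ → ℕ) : Prop := ∃ m, (∀ s, s < m → a s = b s) ∧ a m < b m

/-- Lexicographic order: `SeqLe a b` means `a ≤ b`. -/
def SeqLe (a b : ℕ → ℕ) : Prop := a = b ∨ SeqLt a b

/-- A good sequence of nonnegative integers: eventually zero. -/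
def GoodNatSeq (a : ℕ → ℕ) : Prop := ∃ N, ∀ n, N ≤ n → a n = 0

/-- A weak lower perfect space over a Borcherds–Cartan datum `D`: a `P`-graded
`k`-vector space with finite dimensional weight spaces, weights bounded by
finitely many `λ_j - R_+`, together with endomorphisms `f x = 𝚏_{il}`
lowering the weight by `l·α_i`. -/
structure WeakLowerPerfect {I P : Type*} [AddCommGroup P] (D : BCDatum I P)
    (k : Type*) [Field k] (V : Type*) [AddCommGroup V] [Module k V] where
  wtSp : P → Submodule k V
  wt_indep : iSupIndep wtSp
  wt_total : ⨆ μ, wtSp μ = ⊤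
  wt_findim : ∀ μ, FiniteDimensional k (wtSp μ)
  wt_bdd : ∃ Λ : Finset P, ∀ μ, wtSp μ ≠ ⊥ → ∃ lam ∈ Λ, ∃ β ∈ D.Rplus, μ = lam - β
  f : D.Iinf → Module.End k V
  f_wt : ∀ x μ, ∀ v ∈ wtSp μ, f x v ∈ wtSp (μ - D.wtOf x)

namespace WeakLowerPerfect

variable {I P : Type*} [AddCommGroup P] {D : BCDatum I P}
  {k : Type*} [Field k] {V : Type*} [AddCommGroup V] [Module k V]

/-- `d_{il}(v)`: the largest `n` with `v ∈ 𝚏_{il}^n V` (for `v ≠ 0` in a weak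
lower perfect space this is the unique `n` with `v ∈ 𝚏^n V \ 𝚏^{n+1} V`). -/
def d (W : WeakLowerPerfect D k V) (x : D.Iinf) (v : V) : ℕ :=
  sSup {n | v ∈ LinearMap.range (W.f x ^ n)}

/-- The composite `𝚏_{i_1l_1}^{a_1} ⋯ 𝚏_{i_rl_r}^{a_r}` (`0`-based indexing). -/
def prodF (W : WeakLowerPerfect D k V) (gi : ℕ → D.Iinf) (a : ℕ → ℕ) (r : ℕ) :
    Module.End k V :=
  ((List.range r).map fun j => W.f (gi j) ^ a j).prod

/-- `V^{>𝐢,𝐚} = Σ_{k=1}^r 𝚏_{i_1l_1}^{a_1}⋯𝚏_{i_{k-1}l_{k-1}}^{a_{k-1}} 𝚏_{i_kl_k}^{a_k+1} V`. -/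
def Vgt (W : WeakLowerPerfect D k V) (gi : ℕ → D.Iinf) (a : ℕ → ℕ) (r : ℕ) :
    Submodule k V :=
  ⨆ j ∈ Finset.range r, LinearMap.range (W.prodF gi a j * W.f (gi j) ^ (a j + 1))

/-- `V^{≥𝐢,𝐚} = V^{>𝐢,𝐚} + 𝚏_{i_1l_1}^{a_1}⋯𝚏_{i_rl_r}^{a_r} V`. -/
def Vge (W : WeakLowerPerfect D k V) (gi : ℕ → D.Iinf) (a : ℕ → ℕ) (r : ℕ) :
    Submodule k V :=
  W.Vgt gi a r ⊔ LinearMap.range (W.prodF gi a r)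

end WeakLowerPerfect

/-- A lower perfect basis of a weak lower perfect space: a basis compatible with the
grading, equipped with crystal-type maps `𝐟_{il} : B → B ∪ {0}` approximating the
`𝚏_{il}` modulo `𝚏_{il}^{d_{il}(b)+2} V`, jointly injective. (The maps `flo` are
extended to all of `V`, with the convention `flo x 0 = 0`.) -/
structure LowerPerfectBasis {I P : Type*} [AddCommGroup P] {D : BCDatum I P}
    {k : Type*} [Field k] {V : Type*} [AddCommGroup V] [Module k V]
    (W : WeakLowerPerfect D k V) where
  B : Set V
  linIndep : LinearIndependent k (Subtype.val : B → V)
  spans : Submodule.span k B = ⊤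
  graded : ∀ b ∈ B, ∃ μ, b ∈ W.wtSp μ
  flo : D.Iinf → V → V
  flo_mem : ∀ x, ∀ b ∈ B, flo x b ∈ B ∨ flo x b = 0
  flo_zero : ∀ x, flo x 0 = 0
  flo_approx : ∀ x, ∀ b ∈ B, ∃ c : k, c ≠ 0 ∧
    W.f x b - c • flo x b ∈ LinearMap.range (W.f x ^ (W.d x b + 2))
  flo_joint_inj : ∀ b ∈ B, ∀ b' ∈ B, (∀ x, flo x b = flo x b') → b = b'

namespace LowerPerfectBasis

variable {I P : Type*} [AddCommGroup P] {D : BCDatum I P}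
  {k : Type*} [Field k] {V : Type*} [AddCommGroup V] [Module k V]
  {W : WeakLowerPerfect D k V}

open Classical in
/-- `𝐞_{il} : B → B ∪ {0}`: `𝐞_{il}(b) = b'` if `b = 𝐟_{il}(b')` with `b' ∈ B`,
and `𝐞_{il}(b) = 0` otherwise. -/
def elo (L : LowerPerfectBasis W) (x : D.Iinf) (b : V) : V :=
  if h : b ∈ L.B ∧ ∃ b' ∈ L.B, L.flo x b' = b then h.2.choose else 0

/-- `𝐞_{il}^{top}(b) = 𝐞_{il}^{d_{il}(b)}(b)`. -/
def etop (L : LowerPerfectBasis W) (x : D.Iinf) (b : V) : V :=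
  (L.elo x)^[W.d x b] b

/-- The sequence `b_0 = b`, `b_{k+1} = 𝐞_{i_{k+1}l_{k+1}}^{top}(b_k)` (0-based). -/
def bseq (L : LowerPerfectBasis W) (gi : ℕ → D.Iinf) (b : V) (n : ℕ) : V :=
  Nat.rec (motive := fun _ => V) b (fun m prev => L.etop (gi m) prev) n

/-- The sequence `𝐝(𝐢,b)`: `d_k = d_{i_kl_k}(b_{k-1})` (0-based). -/
def dseq (L : LowerPerfectBasis W) (gi : ℕ → D.Iinf) (b : V) (n : ℕ) : ℕ :=
  W.d (gi n) (L.bseq gi b n)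

/-- The highest core `B_H = {b ∈ B : d_{il}(b) = 0 for all (i,l)}`. -/
def BH (L : LowerPerfectBasis W) : Set V := {b ∈ L.B | ∀ x, W.d x b = 0}

/-- The iterated crystal map `𝐟_{i_1l_1}^{a_1} ⋯ 𝐟_{i_rl_r}^{a_r}` (0-based). -/
def floSeq (L : LowerPerfectBasis W) (gi : ℕ → D.Iinf) (a : ℕ → ℕ) (r : ℕ) : V → V :=
  Nat.rec (motive := fun _ => V → V) id
    (fun n F => fun b => F ((L.flo (gi n))^[a n] b)) r

/-- The iterated crystal map `𝐞_{i_rl_r}^{a_r} ⋯ 𝐞_{i_1l_1}^{a_1}` (0-based). -/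
def eloSeq (L : LowerPerfectBasis W) (gi : ℕ → D.Iinf) (a : ℕ → ℕ) (r : ℕ) : V → V :=
  Nat.rec (motive := fun _ => V → V) id
    (fun n F => fun b => (L.elo (gi n))^[a n] (F b)) r

end LowerPerfectBasis

/-- A weak upper perfect space: like a weak lower perfect space, but the
endomorphisms `e x = 𝚎_{il}` raise the weight by `l·α_i`. -/
structure WeakUpperPerfect {I P : Type*} [AddCommGroup P] (D : BCDatum I P)
    (k : Type*) [Field k] (V : Type*) [AddCommGroup V] [Module k V] where
  wtSp : P → Submodule k V
  wt_indep : iSupIndep wtSp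
  wt_total : ⨆ μ, wtSp μ = ⊤
  wt_findim : ∀ μ, FiniteDimensional k (wtSp μ)
  wt_bdd : ∃ Λ : Finset P, ∀ μ, wtSp μ ≠ ⊥ → ∃ lam ∈ Λ, ∃ β ∈ D.Rplus, μ = lam - β
  e : D.Iinf → Module.End k V
  e_wt : ∀ x μ, ∀ v ∈ wtSp μ, e x v ∈ wtSp (μ + D.wtOf x)

namespace WeakUpperPerfect

variable {I P : Type*} [AddCommGroup P] {D : BCDatum I P}
  {k : Type*} [Field k] {V : Type*} [AddCommGroup V] [Module k V]

/-- `d^∨_{il}(v) = max{n ≥ 0 : 𝚎_{il}^n v ≠ 0}`. -/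
def dv (W : WeakUpperPerfect D k V) (x : D.Iinf) (v : V) : ℕ :=
  sSup {n | (W.e x ^ n) v ≠ 0}

end WeakUpperPerfect

/-- An upper perfect basis of a weak upper perfect space. -/
structure UpperPerfectBasis {I P : Type*} [AddCommGroup P] {D : BCDatum I P}
    {k : Type*} [Field k] {V : Type*} [AddCommGroup V] [Module k V]
    (W : WeakUpperPerfect D k V) where
  B : Set V
  linIndep : LinearIndependent k (Subtype.val : B → V)
  spans : Submodule.span k B = ⊤
  graded : ∀ b ∈ B, ∃ μ, b ∈ W.wtSp μ
  Elo : D.Iinf → V → V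
  Elo_zero : ∀ x, ∀ b ∈ B, W.dv x b = 0 → Elo x b = 0
  Elo_mem : ∀ x, ∀ b ∈ B, 0 < W.dv x b → Elo x b ∈ B
  Elo_approx : ∀ x, ∀ b ∈ B, 0 < W.dv x b → ∃ c : k, c ≠ 0 ∧
    W.e x b - c • Elo x b ∈ LinearMap.ker (W.e x ^ (W.dv x b - 1))
  Elo_joint_inj : ∀ b ∈ B, ∀ b' ∈ B, (∀ x, Elo x b = Elo x b') → b = b'

/-- A bilinear pairing realizing `V'` as the graded dual of the weak lower perfect
space `V`, with `𝚎_{il}` adjoint to `𝚏_{il}`. -/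
structure IsGradedDualPair {I P : Type*} [AddCommGroup P] {D : BCDatum I P}
    {k : Type*} [Field k] {V V' : Type*} [AddCommGroup V] [Module k V]
    [AddCommGroup V'] [Module k V']
    (W : WeakLowerPerfect D k V) (W' : WeakUpperPerfect D k V')
    (pr : V →ₗ[k] V' →ₗ[k] k) : Prop where
  orth : ∀ μ ν, μ ≠ ν → ∀ u ∈ W.wtSp μ, ∀ v ∈ W'.wtSp ν, pr u v = 0
  nondeg : ∀ μ, ∀ v ∈ W'.wtSp μ, (∀ u ∈ W.wtSp μ, pr u v = 0) → v = 0
  onto_dual : ∀ μ, ∀ φ : Module.Dual k (W.wtSp μ), ∃ v ∈ W'.wtSp μ,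
      ∀ u : W.wtSp μ, pr (↑u) v = φ u
  adjoint : ∀ x (u : V) (v : V'), pr u (W'.e x v) = pr (W.f x u) v

open Classical in
/-- `dB` sends each `b ∈ B` to the corresponding dual basis vector `b^∨`
(characterized by `⟨b'', b^∨⟩ = δ_{b'' b}` and living in the dual weight space). -/
def IsDualFamily {I P : Type*} [AddCommGroup P] {D : BCDatum I P}
    {k : Type*} [Field k] {V V' : Type*} [AddCommGroup V] [Module k V]
    [AddCommGroup V'] [Module k V']
    (W : WeakLowerPerfect D k V) (W' : WeakUpperPerfect D k V')
    (pr : V →ₗ[k] V' →ₗ[k] k) (B : Set V) (dB : V → V') : Prop :=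
  (∀ b ∈ B, ∀ b' ∈ B, pr b' (dB b) = if b' = b then (1 : k) else 0) ∧
  (∀ b ∈ B, ∀ μ, b ∈ W.wtSp μ → dB b ∈ W'.wtSp μ)


namespace BCDatum

variable {I P : Type*} [AddCommGroup P] (D : BCDatum I P)

lemma exists_wtOf_eq (x : D.Iinf) : ∃ i, ∃ l : ℕ, 0 < l ∧ D.wtOf x = l • D.α i := by
  rcases x with i | p
  · exact ⟨i.1, 1, one_pos, by simp [wtOf]⟩
  · exact ⟨p.1.1, p.2, p.2.pos, by simp [wtOf]⟩

/-- A weight lies below `lam` by an element of `R_+` after only boundedly many raisings. -/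
lemma exists_bound_of_add_nsmul_wtOf (x : D.Iinf) (μ lam : P) :
    ∃ N : ℕ, ∀ n : ℕ, (∃ β ∈ D.Rplus, μ + n • D.wtOf x = lam - β) → n ≤ N := by
  obtain ⟨i, l, hl, hx⟩ := D.exists_wtOf_eq x
  have hinj : LinearIndependent ℕ D.α :=
    D.roots_indep.restrict_scalars (by intro a b h; simpa using h)
  by_cases h : ∃ n₀ : ℕ, ∃ β ∈ D.Rplus, μ + n₀ • D.wtOf x = lam - β
  · obtain ⟨n₀, _, ⟨c₀, rfl⟩, h₀⟩ := h
    refine ⟨n₀ * l + c₀ i, ?_⟩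
    rintro n ⟨_, ⟨c, rfl⟩, h⟩
    have key : Finsupp.single i (n * l) + c = Finsupp.single i (n₀ * l) + c₀ := by
      apply hinj
      simp only [map_add, Finsupp.linearCombination_single, mul_smul, ← hx]
      simp only [Finsupp.linearCombination_apply]
      rw [eq_sub_iff_add_eq, add_assoc] at h h₀
      exact add_left_cancel (h.trans h₀.symm)
    have := DFunLike.congr_fun key i
    simp only [Finsupp.add_apply, Finsupp.single_eq_same] at this
    have := Nat.le_mul_of_pos_right n hl
    omega
  · exact ⟨0, fun n hn => (h ⟨n, hn⟩).elim⟩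

end BCDatum

namespace WeakLowerPerfect

variable {I P : Type*} [AddCommGroup P] {D : BCDatum I P}
  {k : Type*} [Field k] {V : Type*} [AddCommGroup V] [Module k V]
  (W : WeakLowerPerfect D k V)

lemma range_f_pow_anti (x : D.Iinf) {m n : ℕ} (h : m ≤ n) :
    LinearMap.range (W.f x ^ n) ≤ LinearMap.range (W.f x ^ m) := by
  obtain ⟨j, rfl⟩ := Nat.exists_eq_add_of_le h
  rw [pow_add]
  exact LinearMap.range_comp_le_range _ _

lemma f_mem_range_pow_succ (x : D.Iinf) {n : ℕ} {v : V}
    (hv : v ∈ LinearMap.range (W.f x ^ n)) :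
    W.f x v ∈ LinearMap.range (W.f x ^ (n + 1)) := by
  obtain ⟨u, rfl⟩ := hv
  exact ⟨u, by rw [pow_succ']; rfl⟩

lemma f_pow_mem_wtSp (x : D.Iinf) (n : ℕ) {μ : P} {v : V} (hv : v ∈ W.wtSp μ) :
    (W.f x ^ n) v ∈ W.wtSp (μ - n • D.wtOf x) := by
  induction n with
  | zero => simpa using hv
  | succ n ih =>
    rw [pow_succ', succ_nsmul, ← sub_sub]
    exact W.f_wt x _ _ ih

lemma wtSp_ne_bot_of_mem_range (x : D.Iinf) (n : ℕ) {μ : P} {v : V} (hv : v ∈ W.wtSp μ)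
    (hv₀ : v ≠ 0) (h : v ∈ LinearMap.range (W.f x ^ n)) :
    W.wtSp (μ + n • D.wtOf x) ≠ ⊥ := by
  intro hbot
  obtain ⟨u, rfl⟩ := h
  have hle : (⊤ : Submodule k V) ≤
      (⨆ κ, ⨆ _ : κ ≠ μ, W.wtSp κ).comap (W.f x ^ n) := by
    rw [← W.wt_total]
    refine iSup_le fun ν w hw => ?_
    by_cases hν : ν = μ + n • D.wtOf x
    · rw [hν, hbot, Submodule.mem_bot] at hw
      simp [hw]
    · have hne : ν - n • D.wtOf x ≠ μ := fun h' => hν (sub_eq_iff_eq_add.mp h')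
      exact Submodule.mem_iSup_of_mem _
        (Submodule.mem_iSup_of_mem hne (W.f_pow_mem_wtSp x n hw))
  exact hv₀ (Submodule.disjoint_def.mp (W.wt_indep μ) _ hv (hle Submodule.mem_top))

lemma bddAbove_mem_range_f_pow (x : D.Iinf) {μ : P} {v : V} (hv : v ∈ W.wtSp μ)
    (hv₀ : v ≠ 0) : BddAbove {n | v ∈ LinearMap.range (W.f x ^ n)} := by
  obtain ⟨Λ, hΛ⟩ := W.wt_bdd
  choose N hN using D.exists_bound_of_add_nsmul_wtOf x μ
  refine ⟨Λ.sup N, fun n hn => ?_⟩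
  obtain ⟨lam, hlam, hβ⟩ := hΛ _ (W.wtSp_ne_bot_of_mem_range x n hv hv₀ hn)
  exact (hN lam n hβ).trans (Finset.le_sup hlam)

lemma mem_range_f_pow_d (x : D.Iinf) {μ : P} {v : V} (hv : v ∈ W.wtSp μ) (hv₀ : v ≠ 0) :
    v ∈ LinearMap.range (W.f x ^ W.d x v) :=
  Nat.sSup_mem (s := {n | v ∈ LinearMap.range (W.f x ^ n)}) ⟨0, by simp⟩
    (W.bddAbove_mem_range_f_pow x hv hv₀)

lemma le_d_of_mem_range (x : D.Iinf) {μ : P} {v : V} (hv : v ∈ W.wtSp μ) (hv₀ : v ≠ 0)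
    {n : ℕ} (h : v ∈ LinearMap.range (W.f x ^ n)) : n ≤ W.d x v :=
  le_csSup (W.bddAbove_mem_range_f_pow x hv hv₀) h

end WeakLowerPerfect

namespace LowerPerfectBasis

variable {I P : Type*} [AddCommGroup P] {D : BCDatum I P}
  {k : Type*} [Field k] {V : Type*} [AddCommGroup V] [Module k V]
  {W : WeakLowerPerfect D k V} (L : LowerPerfectBasis W)

lemma ne_zero {b : V} (hb : b ∈ L.B) : b ≠ 0 :=
  L.linIndep.ne_zero ⟨b, hb⟩

lemma iterate_flo_mem (x : D.Iinf) {b : V} (hb : b ∈ L.B) (n : ℕ) :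
    (L.flo x)^[n] b ∈ L.B ∨ (L.flo x)^[n] b = 0 := by
  induction n with
  | zero => exact Or.inl hb
  | succ n ih =>
    rw [Function.iterate_succ_apply']
    rcases ih with h | h
    · exact L.flo_mem x _ h
    · exact Or.inr (by rw [h, L.flo_zero])

/-- If `b ∈ B` lies in `𝚏^m V`, then `𝐟 b` approximates `𝚏 b` modulo `𝚏^{m+2} V`. -/
lemma flo_approx_of_mem_range (x : D.Iinf) {b : V} (hb : b ∈ L.B ∨ b = 0) {m : ℕ}
    (hm : b ∈ LinearMap.range (W.f x ^ m)) :
    ∃ c : k, c ≠ 0 ∧ W.f x b - c • L.flo x b ∈ LinearMap.range (W.f x ^ (m + 2)) := by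
  rcases hb with hb | rfl
  · obtain ⟨μ, hμ⟩ := L.graded b hb
    obtain ⟨c, hc, h⟩ := L.flo_approx x b hb
    have := W.le_d_of_mem_range x hμ (L.ne_zero hb) hm
    exact ⟨c, hc, W.range_f_pow_anti x (by omega) h⟩
  · exact ⟨1, one_ne_zero, by simp [L.flo_zero]⟩

lemma flo_mem_range (x : D.Iinf) {b : V} (hb : b ∈ L.B ∨ b = 0) {m : ℕ}
    (hm : b ∈ LinearMap.range (W.f x ^ m)) :
    L.flo x b ∈ LinearMap.range (W.f x ^ (m + 1)) := by
  obtain ⟨c, hc, h⟩ := L.flo_approx_of_mem_range x hb hm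
  have h' := sub_mem (W.f_mem_range_pow_succ x hm) (W.range_f_pow_anti x (Nat.le_succ _) h)
  rw [sub_sub_cancel] at h'
  exact (Submodule.smul_mem_iff _ hc).mp h'

lemma iterate_flo_mem_range (x : D.Iinf) {b : V} (hb : b ∈ L.B) (n : ℕ) :
    (L.flo x)^[n] b ∈ LinearMap.range (W.f x ^ (W.d x b + n)) := by
  induction n with
  | zero =>
    obtain ⟨μ, hμ⟩ := L.graded b hb
    exact W.mem_range_f_pow_d x hμ (L.ne_zero hb)
  | succ n ih =>
    rw [Function.iterate_succ_apply']
    exact L.flo_mem_range x (L.iterate_flo_mem x hb n) ih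

end LowerPerfectBasis

/-- Lemma 7.4(a). For any `b ∈ B`, `n ∈ ℤ_{≥0}` and `(i,l) ∈ I^∞`,
there exists `c ∈ k^×` with `𝚏_{il}^n(b) − c·𝐟_{il}^n(b) ∈ 𝚏_{il}^{d_{il}(b)+n+1} V`. -/
theorem statement0 {I P : Type*} [AddCommGroup P] {D : BCDatum I P}
    {k V : Type*} [Field k] [AddCommGroup V] [Module k V]
    (W : WeakLowerPerfect D k V) (L : LowerPerfectBasis W)
    (b : V) (hb : b ∈ L.B) (n : ℕ) (x : D.Iinf) :
    ∃ c : k, c ≠ 0 ∧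
      (W.f x ^ n) b - c • (L.flo x)^[n] b ∈
        LinearMap.range (W.f x ^ (W.d x b + n + 1)) := by
  induction n with
  | zero => exact ⟨1, one_ne_zero, by simp⟩
  | succ n ih =>
    obtain ⟨c, hc, h⟩ := ih
    obtain ⟨c', hc', h'⟩ := L.flo_approx_of_mem_range x (L.iterate_flo_mem x hb n)
      (L.iterate_flo_mem_range x hb n)
    refine ⟨c * c', mul_ne_zero hc hc', ?_⟩
    have := add_mem (W.f_mem_range_pow_succ x h) (Submodule.smul_mem _ c h')
    rwa [map_sub, map_smul, smul_sub, sub_add_sub_cancel, ← Module.End.mul_apply, ← pow_succ',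
      smul_smul, ← Function.iterate_succ_apply' (L.flo x)] at this

end
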